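/- arXiv:2101.05531 — 3 statements merged into one kernel-verified Lean document; each statement's English description precedes it below -/
import Mathlib

section
/- Let R be an order in L and let I and J be fractional R-ideals. Then (J^t·I)^t = (J : I). -/
variable {L : Type*} [CommRing L] [Algebra ℚ L]

/-- A full lattice in `L`: a finitely generated `ℤ`-submodule containing a `ℚ`-basis of `L`
(equivalently, spanning `L` over `ℚ`). -/
def IsFullLattice (I : Submodule ℤ L) : Prop :=
  I.FG ∧ Submodule.span ℚ (I : Set L) = ⊤

/-- The trace dual lattice `I^t = {x ∈ L : Tr_{L/ℚ}(x·y) ∈ ℤ for all y ∈ I}`. -/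
def traceDual (I : Submodule ℤ L) : Submodule ℤ L where
  carrier := {x | ∀ y ∈ I, ∃ n : ℤ, Algebra.trace ℚ L (x * y) = (n : ℚ)}
  zero_mem' := fun y _ => ⟨0, by simp⟩
  add_mem' := by
    intro a b ha hb y hy
    obtain ⟨m, hm⟩ := ha y hy
    obtain ⟨n, hn⟩ := hb y hy
    exact ⟨m + n, by rw [add_mul, map_add, hm, hn]; push_cast; ring⟩
  smul_mem' := by
    intro c x hx y hy
    obtain ⟨n, hn⟩ := hx y hy
    refine ⟨c * n, ?_⟩
    rw [smul_mul_assoc, map_zsmul, hn, zsmul_eq_mul]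
    push_cast
    ring

/-- An order in `L`: a full lattice that is also a subring of `L`. -/
def IsOrderLattice (R : Submodule ℤ L) : Prop :=
  IsFullLattice R ∧ (1 : L) ∈ R ∧ ∀ x ∈ R, ∀ y ∈ R, x * y ∈ R

/-- A fractional `R`-ideal: a full lattice that is an `R`-submodule of `L`. -/
def IsFracIdeal (R I : Submodule ℤ L) : Prop :=
  IsFullLattice I ∧ ∀ r ∈ R, ∀ x ∈ I, r * x ∈ I

theorem mem_traceDual {I : Submodule ℤ L} {x : L} :
    x ∈ traceDual I ↔ ∀ y ∈ I, ∃ n : ℤ, Algebra.trace ℚ L (x * y) = (n : ℚ) :=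
  Iff.rfl

theorem traceDual_eq_dualSubmodule (I : Submodule ℤ L) :
    traceDual I = (Algebra.traceForm ℚ L).dualSubmodule I := by
  ext x
  simp only [mem_traceDual, LinearMap.BilinForm.mem_dualSubmodule, Algebra.traceForm_apply,
    Submodule.mem_one, eq_intCast, eq_comm]

theorem traceForm_nondegenerate_of_forall
    (hnd : ∀ x : L, (∀ y : L, Algebra.trace ℚ L (x * y) = 0) → x = 0) :
    (Algebra.traceForm ℚ L).Nondegenerate :=
  ⟨hnd, fun x hx => hnd x fun y => by
    rw [mul_comm]
    exact hx y⟩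

/-- A full lattice is its own trace bidual. -/
theorem traceDual_traceDual
    (hnd : ∀ x : L, (∀ y : L, Algebra.trace ℚ L (x * y) = 0) → x = 0)
    {J : Submodule ℤ L} (hJ : IsFullLattice J) : traceDual (traceDual J) = J := by
  have : Submodule.IsLattice ℚ J := ⟨hJ.1, hJ.2⟩
  have : Module.Free ℤ J := Submodule.IsLattice.free ℚ J
  let b := Module.Free.chooseBasis ℤ J
  have hspan : Submodule.span ℤ (Set.range (b.extendOfIsLattice ℚ)) = J := by
    have hrange : Set.range (b.extendOfIsLattice ℚ) = J.subtype '' Set.range b := by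
      rw [← Set.range_comp]
      congr 1
      ext k
      simp
    rw [hrange, Submodule.span_image, b.span_eq, Submodule.map_top, Submodule.range_subtype]
  rw [traceDual_eq_dualSubmodule, traceDual_eq_dualSubmodule, ← hspan]
  exact LinearMap.BilinForm.dualSubmodule_dualSubmodule_of_basis _
    (traceForm_nondegenerate_of_forall hnd) (Algebra.traceForm_isSymm ℚ) _

theorem traceDual_mul (I K : Submodule ℤ L) : traceDual (K * I) = traceDual K / I := by
  ext x
  rw [Submodule.mem_div_iff_forall_mul_mem]
  constructor
  · intro hx y hy a ha
    rw [mul_assoc, mul_comm y a]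
    exact hx _ (Submodule.mul_mem_mul ha hy)
  · intro hx z hz
    induction hz using Submodule.mul_induction_on' with
    | mem_mul_mem a ha y hy =>
      rw [mul_comm a y, ← mul_assoc]
      exact hx y hy a ha
    | add u _ v _ hu hv =>
      obtain ⟨m, hm⟩ := hu
      obtain ⟨n, hn⟩ := hv
      exact ⟨m + n, by rw [mul_add, map_add, hm, hn, Int.cast_add]⟩

/-- Let `L` be an étale `ℚ`-algebra (finite-dimensional with nondegenerate
trace form), `R` an order in `L`, and `I`, `J` fractional `R`-ideals.
Then `(J^t·I)^t = (J : I)`.  Here `(J : I)` is written `J / I`. -/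
theorem traceDual_mul_traceDual [FiniteDimensional ℚ L]
    (hnd : ∀ x : L, (∀ y : L, Algebra.trace ℚ L (x * y) = 0) → x = 0)
    (R I J : Submodule ℤ L) (hR : IsOrderLattice R)
    (hI : IsFracIdeal R I) (hJ : IsFracIdeal R J) :
    traceDual (traceDual J * I) = J / I := by
  rw [traceDual_mul, traceDual_traceDual hnd hJ.1]
end

section
/- Let b ∈ L be nonzero and totally imaginary, and let x ∈ L be totally imaginary. Then x is Φ_b-positive if and only if x/b is totally positive. -/
variable {L : Type*} [Field L] [NumberField L]

/-- `x ∈ L` is totally real w.r.t. the CM involution `σ`. -/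
def TotallyReal (σ : L ≃ₐ[ℚ] L) (x : L) : Prop := σ x = x

/-- `x ∈ L` is totally imaginary w.r.t. the CM involution `σ`. -/
def TotallyImaginary (σ : L ≃ₐ[ℚ] L) (x : L) : Prop := σ x = -x

/-- `x ∈ L` is totally positive: totally real and every complex embedding sends it to a
positive real number. -/
def TotallyPositive (σ : L ≃ₐ[ℚ] L) (x : L) : Prop :=
  σ x = x ∧ ∀ φ : L →+* ℂ, (φ x).im = 0 ∧ 0 < (φ x).re

/-- The CM-type `Φ_b` attached to a (nonzero totally imaginary) element `b ∈ L`: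
the set of complex embeddings `φ` with `Im (φ b) > 0`. -/
def CMType (b : L) : Set (L →+* ℂ) := {φ | 0 < (φ b).im}

/-- `x ∈ L` is `Φ_b`-positive: `Im (φ x) > 0` for every `φ ∈ Φ_b`. -/
def PhiPositive (b x : L) : Prop := ∀ φ ∈ CMType b, 0 < (φ x).im

/-- A totally imaginary element has purely imaginary image under every complex embedding. -/
theorem TotallyImaginary.re_map_eq_zero {σ : L ≃ₐ[ℚ] L}
    (hσ : ∀ (φ : L →+* ℂ) (x : L), φ (σ x) = (starRingEnd ℂ) (φ x))
    {x : L} (hx : TotallyImaginary σ x) (φ : L →+* ℂ) : (φ x).re = 0 := by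
  have h := congrArg Complex.re (hσ φ x)
  rw [show σ x = -x from hx, map_neg, Complex.neg_re, Complex.conj_re] at h
  linarith

/-- A quotient of purely imaginary complex numbers is the quotient of the imaginary parts. -/
theorem Complex.div_eq_ofReal_im_div_im {z w : ℂ} (hz : z.re = 0) (hw : w.re = 0) :
    z / w = ((z.im / w.im : ℝ) : ℂ) := by
  have key : ∀ {u : ℂ}, u.re = 0 → u = u.im * Complex.I := fun {u} hu => by
    apply Complex.ext <;> simp [hu]
  conv_lhs => rw [key hz, key hw]
  rw [mul_div_mul_right _ _ Complex.I_ne_zero, Complex.ofReal_div]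

/-- Let `b ∈ L` be nonzero totally imaginary and `x ∈ L` totally imaginary.
Then `x` is `Φ_b`-positive if and only if `x/b` is totally positive. -/
theorem phiPositive_iff_totallyPositive_div (σ : L ≃ₐ[ℚ] L)
    (hσ : ∀ (φ : L →+* ℂ) (x : L), φ (σ x) = (starRingEnd ℂ) (φ x))
    (b x : L) (hb0 : b ≠ 0) (hb : TotallyImaginary σ b)
    (hx : TotallyImaginary σ x) :
    PhiPositive b x ↔ TotallyPositive σ (x / b) := by
  have hdiv (φ : L →+* ℂ) : φ (x / b) = (((φ x).im / (φ b).im : ℝ) : ℂ) := by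
    rw [map_div₀, Complex.div_eq_ofReal_im_div_im (hx.re_map_eq_zero hσ φ)
      (hb.re_map_eq_zero hσ φ)]
  constructor
  · intro h
    refine ⟨?_, fun φ => ?_⟩
    · rw [map_div₀, show σ x = -x from hx, show σ b = -b from hb, neg_div_neg_eq]
    · rw [hdiv φ, Complex.ofReal_im, Complex.ofReal_re]
      refine ⟨rfl, ?_⟩
      have hne : (φ b).im ≠ 0 := fun h0 =>
        (map_ne_zero φ).2 hb0 (Complex.ext (hb.re_map_eq_zero hσ φ) h0)
      rcases hne.lt_or_gt with hneg | hpos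
      · have hconj : 0 < (((starRingEnd ℂ).comp φ) x).im :=
          h ((starRingEnd ℂ).comp φ) (by simpa [CMType] using hneg)
        exact div_pos_of_neg_of_neg (by simpa using hconj) hneg
      · exact div_pos (h φ hpos) hpos
  · rintro ⟨-, h⟩ φ hφ
    have hpos := (h φ).2
    rw [hdiv φ, Complex.ofReal_re] at hpos
    exact (div_pos_iff_of_pos_right hφ).1 hpos
end

section
/- Let S and T be orders in L with σ(T) = T, let 𝒯 ⊆ Tˣ be a transversal of Tˣ modulo H, let i₀ ∈ L be nonzero, and let b ∈ L be nonzero totally imaginary. Assume that for every totally real unit ξ of S there exist u ∈ 𝒯 and a totally positive p ∈ L with u = ξ·p. Then for every totally real unit α of S there is a bijection between P_α(Φ_b) and P_1(Φ_b). -/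
variable {L : Type*} [Field L] [NumberField L]

/-- A unit of an order (subring) `T` of `L`: an element of `T` with an inverse in `T`. -/
def IsUnitOfOrder (T : Subring L) (u : L) : Prop := u ∈ T ∧ ∃ v ∈ T, u * v = 1

/-- An order in `L`: a subring which is finitely generated as a `ℤ`-module and contains a
`ℚ`-basis of `L` (i.e. spans `L` over `ℚ`). -/
def IsOrder (T : Subring L) : Prop :=
  (Submodule.span ℤ (T : Set L)).FG ∧ Submodule.span ℚ (T : Set L) = ⊤

/-- `𝒯` is a transversal of `Tˣ` modulo the subgroup `H` generated by
`{v·σ(v) : v ∈ Tˣ}` (when `σ(T) = T` this generating set is itself a subgroup, since it is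
closed under products and inverses, so `H = {v·σ(v) : v ∈ Tˣ}`): every unit of `T` is
congruent modulo `H` to exactly one element of `𝒯`. -/
def IsTransversal (σ : L ≃ₐ[ℚ] L) (T : Subring L) (𝒯 : Set L) : Prop :=
  (∀ u ∈ 𝒯, IsUnitOfOrder T u) ∧
  ∀ u : L, IsUnitOfOrder T u →
    ∃! t : L, t ∈ 𝒯 ∧ ∃ v : L, IsUnitOfOrder T v ∧ u = t * (v * σ v)

/-- The set `P_α(Φ_b) = {i₀·u : u ∈ 𝒯 such that α⁻¹·i₀·u is totally imaginary and
Φ_b-positive}`; the set `P_1(Φ_b)` is the special case `α = 1`. -/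
def Pset (σ : L ≃ₐ[ℚ] L) (𝒯 : Set L) (i₀ α b : L) : Set L :=
  {x | ∃ u ∈ 𝒯, x = i₀ * u ∧ TotallyImaginary σ (α⁻¹ * (i₀ * u)) ∧
    PhiPositive b (α⁻¹ * (i₀ * u))}

theorem IsUnitOfOrder.ne_zero {T : Subring L} {u : L} (h : IsUnitOfOrder T u) : u ≠ 0 := by
  obtain ⟨-, v, -, huv⟩ := h
  exact left_ne_zero_of_mul_eq_one huv

theorem IsUnitOfOrder.inv {T : Subring L} {u : L} (h : IsUnitOfOrder T u) :
    IsUnitOfOrder T u⁻¹ := by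
  have h0 := h.ne_zero
  obtain ⟨hu, v, hv, huv⟩ := h
  have : u⁻¹ = v := inv_eq_of_mul_eq_one_right huv
  exact ⟨this ▸ hv, u, hu, inv_mul_cancel₀ h0⟩

theorem IsUnitOfOrder.mul {T : Subring L} {u v : L} (hu : IsUnitOfOrder T u)
    (hv : IsUnitOfOrder T v) : IsUnitOfOrder T (u * v) := by
  obtain ⟨hu, u', hu', huu⟩ := hu
  obtain ⟨hv, v', hv', hvv⟩ := hv
  refine ⟨T.mul_mem hu hv, u' * v', T.mul_mem hu' hv', ?_⟩
  rw [mul_mul_mul_comm, huu, hvv, one_mul]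

theorem TotallyPositive.mul {σ : L ≃ₐ[ℚ] L} {p q : L} (hp : TotallyPositive σ p)
    (hq : TotallyPositive σ q) : TotallyPositive σ (p * q) := by
  refine ⟨by rw [map_mul, hp.1, hq.1], fun φ => ?_⟩
  obtain ⟨hp1, hp2⟩ := hp.2 φ
  obtain ⟨hq1, hq2⟩ := hq.2 φ
  simp only [map_mul, Complex.mul_im, Complex.mul_re, hp1, hq1]
  exact ⟨by ring, by simpa using mul_pos hp2 hq2⟩

theorem TotallyPositive.inv {σ : L ≃ₐ[ℚ] L} {p : L} (hp : TotallyPositive σ p) :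
    TotallyPositive σ p⁻¹ := by
  refine ⟨by rw [map_inv₀, hp.1], fun φ => ?_⟩
  obtain ⟨hp1, hp2⟩ := hp.2 φ
  have h0 : 0 < Complex.normSq (φ p) :=
    Complex.normSq_pos.2 fun h => by simp [h] at hp2
  simp only [map_inv₀, Complex.inv_im, Complex.inv_re, hp1]
  exact ⟨by simp, div_pos hp2 h0⟩

theorem totallyPositive_mul_conj {σ : L ≃ₐ[ℚ] L}
    (hσ : ∀ (φ : L →+* ℂ) (x : L), φ (σ x) = (starRingEnd ℂ) (φ x))
    {v : L} (hv : v ≠ 0) : TotallyPositive σ (v * σ v) := by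
  have key (φ : L →+* ℂ) : φ (v * σ v) = (Complex.normSq (φ v) : ℂ) := by
    rw [map_mul, hσ, Complex.mul_conj]
  refine ⟨?_, fun φ => ?_⟩
  · obtain ⟨φ⟩ : Nonempty (L →+* ℂ) := inferInstance
    apply φ.injective
    rw [hσ, key, Complex.conj_ofReal]
  · rw [key]
    exact ⟨Complex.ofReal_im _, by
      rw [Complex.ofReal_re]; exact Complex.normSq_pos.2 ((map_ne_zero φ).2 hv)⟩

theorem TotallyImaginary.mul_totallyPositive {σ : L ≃ₐ[ℚ] L} {x q : L}
    (hx : TotallyImaginary σ x) (hq : TotallyPositive σ q) : TotallyImaginary σ (x * q) := by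
  unfold TotallyImaginary at *
  rw [map_mul, hx, hq.1, neg_mul]

theorem PhiPositive.mul_totallyPositive {σ : L ≃ₐ[ℚ] L} {b x q : L}
    (hx : PhiPositive b x) (hq : TotallyPositive σ q) : PhiPositive b (x * q) := by
  intro φ hφ
  rw [map_mul, Complex.mul_im, (hq.2 φ).1, mul_zero, zero_add]
  exact mul_pos (hx φ hφ) (hq.2 φ).2

/-- Multiplying by a unit `w` with `a * w * c⁻¹` totally positive and passing to the
representative in the transversal maps `P_a(Φ_b)` to `P_c(Φ_b)`. -/
theorem Pset_mul_representative_mem {σ : L ≃ₐ[ℚ] L}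
    (hσ : ∀ (φ : L →+* ℂ) (x : L), φ (σ x) = (starRingEnd ℂ) (φ x))
    {T : Subring L} {𝒯 : Set L} {i₀ b a c w : L} (ha : a ≠ 0) (hi₀ : i₀ ≠ 0)
    (hp : TotallyPositive σ (a * w * c⁻¹))
    {r : L → L} {x : L} (hx : x ∈ Pset σ 𝒯 i₀ a b) (hr : r (x / i₀ * w) ∈ 𝒯)
    (hrv : ∃ v, IsUnitOfOrder T v ∧ x / i₀ * w = r (x / i₀ * w) * (v * σ v)) :
    i₀ * r (x / i₀ * w) ∈ Pset σ 𝒯 i₀ c b := by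
  obtain ⟨v, hv, hrv⟩ := hrv
  obtain ⟨u, -, rfl, him, hpos⟩ := hx
  have hN := totallyPositive_mul_conj hσ hv.ne_zero
  have hv0 := hv.ne_zero
  have hσv0 : σ v ≠ 0 := (map_ne_zero σ).2 hv0
  have heq : c⁻¹ * (i₀ * r (i₀ * u / i₀ * w)) =
      a⁻¹ * (i₀ * u) * (a * w * c⁻¹ * (v * σ v)⁻¹) := by
    rw [eq_div_of_mul_eq (mul_ne_zero hv0 hσv0) hrv.symm]
    field_simp
  refine ⟨_, hr, rfl, ?_⟩
  rw [heq]
  exact ⟨him.mul_totallyPositive (hp.mul hN.inv), hpos.mul_totallyPositive (hp.mul hN.inv)⟩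

/-- Multiplying by `w` and then by `w'` with `w * w' = 1`, taking representatives in the
transversal each time, is the identity on the transversal. -/
theorem IsTransversal.representative_mul_representative {σ : L ≃ₐ[ℚ] L} {T : Subring L}
    {𝒯 : Set L} (h𝒯 : IsTransversal σ T 𝒯) {r : L → L}
    (hr : ∀ u, IsUnitOfOrder T u →
      r u ∈ 𝒯 ∧ ∃ v, IsUnitOfOrder T v ∧ u = r u * (v * σ v))
    {u w w' : L} (hu : u ∈ 𝒯) (hw : IsUnitOfOrder T w) (hw' : IsUnitOfOrder T w')
    (hww' : w * w' = 1) : r (r (u * w) * w') = u := by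
  obtain ⟨hm, v, hv, huv⟩ := hr _ ((h𝒯.1 u hu).mul hw)
  have hunit := (h𝒯.1 _ hm).mul hw'
  refine (h𝒯.2 _ hunit).unique (hr _ hunit) ⟨hu, v⁻¹, hv.inv, ?_⟩
  have hv0 := hv.ne_zero
  have hσv0 : σ v ≠ 0 := (map_ne_zero σ).2 hv0
  have h0 := mul_ne_zero hv0 hσv0
  apply mul_right_cancel₀ h0
  calc r (u * w) * w' * (v * σ v) = r (u * w) * (v * σ v) * w' := by ring
    _ = u * (w * w') := by rw [← huv, mul_assoc]
    _ = u * (v⁻¹ * σ v⁻¹) * (v * σ v) := by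
      rw [hww', map_inv₀]
      field_simp

/-- Theorem 5.10, (2) ⇒ (4): With `S`, `T` orders in `L`, `T` stable
under `σ`, `𝒯` a transversal of `Tˣ` modulo `H`, `i₀ ∈ L` nonzero and `b ∈ L` nonzero
totally imaginary, if for every totally real unit `ξ` of `S` there exist `u ∈ 𝒯` and a
totally positive `p` with `u = ξ·p`, then for every totally real unit `α` of `S` there is
a bijection between `P_α(Φ_b)` and `P_1(Φ_b)`. -/
theorem Pset_alpha_equiv_Pset_one (σ : L ≃ₐ[ℚ] L)
    (hσ : ∀ (φ : L →+* ℂ) (x : L), φ (σ x) = (starRingEnd ℂ) (φ x))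
    (S T : Subring L) (hS : IsOrder S) (hT : IsOrder T)
    (hTσ : ∀ x : L, σ x ∈ T ↔ x ∈ T)
    (𝒯 : Set L) (h𝒯 : IsTransversal σ T 𝒯)
    (i₀ : L) (hi₀ : i₀ ≠ 0)
    (b : L) (hb0 : b ≠ 0) (hb : TotallyImaginary σ b)
    (h2 : ∀ ξ : L, TotallyReal σ ξ → IsUnitOfOrder S ξ →
      ∃ u ∈ 𝒯, ∃ p : L, TotallyPositive σ p ∧ u = ξ * p) :
    ∀ α : L, TotallyReal σ α → IsUnitOfOrder S α →
      Nonempty (Pset σ 𝒯 i₀ α b ≃ Pset σ 𝒯 i₀ 1 b) := by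
  intro α hαr hα
  obtain ⟨w, hw𝒯, p, hp, hwp⟩ := h2 α hαr hα
  have hα0 := hα.ne_zero
  have hw := h𝒯.1 w hw𝒯
  have hw0 := hw.ne_zero
  have hex (u : L) : ∃ t, IsUnitOfOrder T u →
      t ∈ 𝒯 ∧ ∃ v, IsUnitOfOrder T v ∧ u = t * (v * σ v) := by
    by_cases hu : IsUnitOfOrder T u
    · obtain ⟨t, ht, -⟩ := h𝒯.2 u hu
      exact ⟨t, fun _ => ht⟩
    · exact ⟨0, fun h => absurd h hu⟩
  choose r hr using hex
  have hp₁ : TotallyPositive σ (1 * w * α⁻¹) := by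
    have : 1 * w * α⁻¹ = p := by rw [hwp]; field_simp
    rwa [this]
  have hp₂ : TotallyPositive σ (α * w⁻¹ * 1⁻¹) := by
    have : α * w⁻¹ * 1⁻¹ = (1 * w * α⁻¹)⁻¹ := by field_simp
    rw [this]
    exact hp₁.inv
  have hunit {a x y : L} (hx : x ∈ Pset σ 𝒯 i₀ a b) (hy : IsUnitOfOrder T y) :
      IsUnitOfOrder T (x / i₀ * y) := by
    obtain ⟨u, hu, rfl, -⟩ := hx
    rw [mul_div_cancel_left₀ _ hi₀]
    exact (h𝒯.1 u hu).mul hy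
  have hinv {a x y y' : L} (hx : x ∈ Pset σ 𝒯 i₀ a b) (hy : IsUnitOfOrder T y)
      (hy' : IsUnitOfOrder T y') (hyy' : y * y' = 1) :
      i₀ * r (i₀ * r (x / i₀ * y) / i₀ * y') = x := by
    obtain ⟨u, hu, rfl, -⟩ := hx
    rw [mul_div_cancel_left₀ _ hi₀, mul_div_cancel_left₀ _ hi₀,
      h𝒯.representative_mul_representative hr hu hy hy' hyy']
  exact ⟨{
    toFun x := ⟨i₀ * r (x / i₀ * w⁻¹), Pset_mul_representative_mem hσ hα0 hi₀ hp₂ x.2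
      (hr _ (hunit x.2 hw.inv)).1 (hr _ (hunit x.2 hw.inv)).2⟩
    invFun x := ⟨i₀ * r (x / i₀ * w), Pset_mul_representative_mem hσ one_ne_zero hi₀ hp₁ x.2
      (hr _ (hunit x.2 hw)).1 (hr _ (hunit x.2 hw)).2⟩
    left_inv x := Subtype.ext (hinv x.2 hw.inv hw (inv_mul_cancel₀ hw0))
    right_inv x := Subtype.ext (hinv x.2 hw hw.inv (mul_inv_cancel₀ hw0)) }⟩
end
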